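/- Let d ≥ 3, let w be a doubly infinite transient trajectory in ℤ^d, and let n₀ < … < n_J be cut-times of w with n_{j+1} − n_j ≥ 2 for j = 0,…,J−1. Then for all 0 ≤ j < j' ≤ J−1, d_∞(fill(𝒰_j), fill(𝒰_{j'})) > 1. -/

import Mathlib

/-- Points of `ℤ^d`. -/
abbrev Pt (d : ℕ) := Fin d → ℤ

namespace RI

variable {d : ℕ}

/-- `l¹` distance between two points (ℕ-valued). -/
def n1 (x y : Pt d) : ℕ := ∑ j, (x j - y j).natAbs

/-- `l∞` distance between two points (ℕ-valued). -/
def ninf (x y : Pt d) : ℕ := Finset.univ.sup fun j => (x j - y j).natAbs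

/-- nearest-neighbor adjacency: `‖x - y‖₁ = 1` -/
def adj (x y : Pt d) : Prop := n1 x y = 1

/-- `*`-adjacency: `‖x - y‖_∞ = 1` -/
def adjStar (x y : Pt d) : Prop := ninf x y = 1

/-- `τ` is a nearest-neighbor path of length `N`. -/
def IsPath (τ : ℕ → Pt d) (N : ℕ) : Prop := ∀ l < N, adj (τ l) (τ (l + 1))

/-- the range of a path of length `N` -/
def pathRange (τ : ℕ → Pt d) (N : ℕ) : Set (Pt d) := τ '' {l | l ≤ N}

/-- `x` and `y` are joined by a nearest-neighbor path all of whose points lie in `U`. -/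
def ConnIn (U : Set (Pt d)) (x y : Pt d) : Prop :=
  ∃ τ N, IsPath τ N ∧ τ 0 = x ∧ τ N = y ∧ ∀ l ≤ N, τ l ∈ U

/-- a set is connected: any two of its points are joined by a path inside it -/
def ConnSet (A : Set (Pt d)) : Prop := ∀ x ∈ A, ∀ y ∈ A, ConnIn A x y

/-- the connected component of `U` containing `x` -/
def comp (U : Set (Pt d)) (x : Pt d) : Set (Pt d) := {y | ConnIn U x y}

/-- the (outer) boundary `∂K` -/
def bd (K : Set (Pt d)) : Set (Pt d) := {x | x ∉ K ∧ ∃ y ∈ K, adj x y}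

/-- the `*`-boundary `∂*K` -/
def bdStar (K : Set (Pt d)) : Set (Pt d) := {x | x ∉ K ∧ ∃ y ∈ K, adjStar x y}

/-- the interior boundary `∂_int K` -/
def intBd (K : Set (Pt d)) : Set (Pt d) := {x | x ∈ K ∧ ∃ y, y ∉ K ∧ adj x y}

/-- the `l∞` diameter of a set, valued in `ℕ∞` -/
noncomputable def diam (K : Set (Pt d)) : ℕ∞ := ⨆ x ∈ K, ⨆ y ∈ K, (ninf x y : ℕ∞)

/-- the `l¹` distance between `K` and `K'` exceeds `1` -/
def far1 (K K' : Set (Pt d)) : Prop := ∀ x ∈ K, ∀ y ∈ K', 1 < n1 x y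

/-- the `l∞` distance between `K` and `K'` exceeds `1` -/
def farInf (K K' : Set (Pt d)) : Prop := ∀ x ∈ K, ∀ y ∈ K', 1 < ninf x y

/-- `d_∞(K, K') ≤ r` -/
def dInfLE (K K' : Set (Pt d)) (r : ℕ) : Prop := ∃ x ∈ K, ∃ y ∈ K', ninf x y ≤ r

/-- `fill A`: the set of points every connected set around which inside `Aᶜ` is finite;
for `d ≥ 2` and finite `A` this is exactly the complement of the unique infinite
connected component of `Aᶜ`. -/
def fill (A : Set (Pt d)) : Set (Pt d) :=
  {z | ∀ S : Set (Pt d), z ∈ S → S ⊆ Aᶜ → ConnSet S → S.Finite}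

/-- `A₁` and `A₂` are separated by `𝒰` in `B`: `d(A₁,A₂) > 1` and every path in `B`
joining `∂A₁` to `∂A₂` meets `𝒰`. -/
def SeparatedBy (A₁ A₂ 𝒰 B : Set (Pt d)) : Prop :=
  far1 A₁ A₂ ∧
  ∀ τ N, IsPath τ N → (∀ l ≤ N, τ l ∈ B) → τ 0 ∈ bd A₁ → τ N ∈ bd A₂ →
    ∃ l ≤ N, τ l ∈ 𝒰

/-- the scales `L_κ = L₀ (80 L)^κ` -/
def Lscale (L L₀ κ : ℕ) : ℕ := L₀ * (80 * L) ^ κ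

/-- the box `C_{(κ,i)} = (i L_κ + [0, L_κ)^d) ∩ ℤ^d` -/
def boxC (L L₀ κ : ℕ) (i : Pt d) : Set (Pt d) :=
  {x | ∀ j, i j * (Lscale L L₀ κ : ℤ) ≤ x j ∧
    x j < i j * (Lscale L L₀ κ : ℤ) + (Lscale L L₀ κ : ℤ)}

/-- the neighborhood `C_{(κ,i)}^l = ⋃_{‖j‖_∞ < l} C_{(κ, i+j)}` -/
def boxCl (L L₀ κ : ℕ) (i : Pt d) (l : ℕ) : Set (Pt d) :=
  ⋃ j ∈ {j : Pt d | ∀ t, (j t).natAbs < l}, boxC L L₀ κ (i + j)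

/-- the separation event `χ_{(κ,i)}(𝒰) = 1`: there are connected sets
`A₁, A₂ ⊆ C_{(κ,i)}^2` of diameter at least `L_κ / 2` separated by `𝒰` in `C_{(κ,i)}^3` -/
def chi (L L₀ κ : ℕ) (i : Pt d) (𝒰 : Set (Pt d)) : Prop :=
  ∃ A₁ A₂ : Set (Pt d), A₁ ⊆ boxCl L L₀ κ i 2 ∧ A₂ ⊆ boxCl L L₀ κ i 2 ∧
    ConnSet A₁ ∧ ConnSet A₂ ∧
    (Lscale L L₀ κ : ℕ∞) ≤ 2 * diam A₁ ∧ (Lscale L L₀ κ : ℕ∞) ≤ 2 * diam A₂ ∧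
    SeparatedBy A₁ A₂ 𝒰 (boxCl L L₀ κ i 3)

/-- the centered boxes `C^l = [-(l-1)L₀, l L₀)^d ∩ ℤ^d` -/
def boxCen (L₀ l : ℕ) : Set (Pt d) :=
  {x | ∀ j, -(((l : ℤ) - 1) * (L₀ : ℤ)) ≤ x j ∧ x j < (l : ℤ) * (L₀ : ℤ)}

/-- the separation event `χ(𝒰) = 1` for the centered boxes -/
def chi0 (L₀ : ℕ) (𝒰 : Set (Pt d)) : Prop :=
  ∃ A₁ A₂ : Set (Pt d), A₁ ⊆ boxCen L₀ 2 ∧ A₂ ⊆ boxCen L₀ 2 ∧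
    ConnSet A₁ ∧ ConnSet A₂ ∧
    (L₀ : ℕ∞) ≤ 2 * diam A₁ ∧ (L₀ : ℕ∞) ≤ 2 * diam A₂ ∧
    SeparatedBy A₁ A₂ 𝒰 (boxCen L₀ 3)

/-- `A` is `h`-avoidable in `C`: every path in `C` with endpoints outside `A` can be
modified, within `l∞` distance `h` of its range and through `Range(τ) ∪ ∂*A`,
into a path with the same endpoints avoiding `A`. -/
def Avoidable (h : ℝ) (A C : Set (Pt d)) : Prop :=
  ∀ τ N, IsPath τ N → (∀ l ≤ N, τ l ∈ C) → τ 0 ∉ A → τ N ∉ A →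
    ∃ τ' N', IsPath τ' N' ∧ τ' 0 = τ 0 ∧ τ' N' = τ N ∧
      (∀ l ≤ N', τ' l ∉ A) ∧
      (∀ l ≤ N', (∃ k ≤ N, (ninf (τ' l) (τ k) : ℝ) ≤ h) ∧
        (τ' l ∈ pathRange τ N ∨ τ' l ∈ bdStar A))

/-- a doubly infinite transient nearest-neighbor trajectory -/
def IsTraj (w : ℤ → Pt d) : Prop :=
  (∀ l : ℤ, adj (w l) (w (l + 1))) ∧
  Filter.Tendsto (fun l : ℤ => n1 (w l) 0) Filter.cofinite Filter.atTop

/-- `k` is a cut-time of `w`: `d_∞({w(l) : l < k}, {w(l) : l > k}) > 1` -/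
def CutTime (w : ℤ → Pt d) (k : ℤ) : Prop :=
  ∀ l, l < k → ∀ l', k < l' → 1 < ninf (w l) (w l')

/-- the `j`-th sausage `𝒰_j = {w(l) : n_j < l < n_{j+1}}` -/
def sausage (w : ℤ → Pt d) (n : ℕ → ℤ) (j : ℕ) : Set (Pt d) :=
  w '' {l | n j < l ∧ l < n (j + 1)}

/-- boxes: products of integer intervals -/
def IsBox (B : Set (Pt d)) : Prop :=
  ∃ a b : Pt d, B = {x | ∀ j, a j ≤ x j ∧ x j ≤ b j}

/-- the smallest box containing `K` -/
def sbox (K : Set (Pt d)) : Set (Pt d) := ⋂₀ {B | IsBox B ∧ K ⊆ B}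

/-- the closed `l∞` ball `B(x, r)` -/
def ball (x : Pt d) (r : ℕ) : Set (Pt d) := {y | ninf x y ≤ r}

/-- a skeleton: a set of indices at the finest scale satisfying the Wiener-type
spacing conditions -/
def IsSkeleton (L L₀ : ℕ) (M : Finset (Pt d)) : Prop :=
  ∀ m₀ ∈ M,
    (∀ h : ℕ,
      {m : Pt d | m ∈ M ∧
        dInfLE (boxC L L₀ 0 m₀) (boxC L L₀ 0 m) (L * Lscale L L₀ (h + 1)) ∧
        ¬ dInfLE (boxC L L₀ 0 m₀) (boxC L L₀ 0 m) (L * Lscale L L₀ h)}.ncard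
        ≤ 2 ^ (h + 1)) ∧
    ∀ m ∈ M, m ≠ m₀ → ¬ dInfLE (boxC L L₀ 0 m₀) (boxC L L₀ 0 m) (L * Lscale L L₀ 0)

theorem n1_comm (x y : Pt d) : n1 x y = n1 y x :=
  Finset.sum_congr rfl fun j _ => by rw [← Int.natAbs_neg, neg_sub]

theorem adj_symm {x y : Pt d} (h : adj x y) : adj y x := (n1_comm y x).trans h

theorem adj_of_eq_off {x y : Pt d} (i : Fin d) (h : ∀ j ≠ i, x j = y j)
    (hi : (x i - y i).natAbs = 1) : adj x y := by
  unfold adj n1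
  rw [Finset.sum_eq_single i (fun j _ hj => by simp [h j hj]) (by simp), hi]

theorem ConnIn.refl {U : Set (Pt d)} {x : Pt d} (hx : x ∈ U) : ConnIn U x x :=
  ⟨fun _ => x, 0, fun _ hl => absurd hl (Nat.not_lt_zero _), rfl, rfl, fun _ _ => hx⟩

theorem ConnIn.mono {U V : Set (Pt d)} {x y : Pt d} (hUV : U ⊆ V) :
    ConnIn U x y → ConnIn V x y := fun ⟨τ, N, hp, h0, hN, hU⟩ =>
  ⟨τ, N, hp, h0, hN, fun l hl => hUV (hU l hl)⟩

theorem ConnIn.symm {U : Set (Pt d)} {x y : Pt d} : ConnIn U x y → ConnIn U y x := by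
  rintro ⟨τ, N, hp, h0, hN, hU⟩
  refine ⟨fun l => τ (N - l), N, fun l hl => adj_symm ?_, by simpa using hN, by simpa using h0,
    fun l _ => hU _ (Nat.sub_le _ _)⟩
  have h := hp (N - (l + 1)) (by omega)
  rwa [show N - (l + 1) + 1 = N - l by omega] at h

theorem ConnIn.tail {U : Set (Pt d)} {x y z : Pt d} (h : ConnIn U x y) (hyz : adj y z)
    (hz : z ∈ U) : ConnIn U x z := by
  obtain ⟨τ, N, hp, h0, hN, hU⟩ := h
  refine ⟨fun l => if l ≤ N then τ l else z, N + 1, fun l hl => ?_, by simpa using h0, by simp,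
    fun l _ => ?_⟩
  · rcases Nat.lt_succ_iff_lt_or_eq.mp hl with h | rfl
    · simpa [h.le, Nat.succ_le_of_lt h] using hp l h
    · simpa [hN] using hyz
  · by_cases h : l ≤ N
    · simpa [h] using hU l h
    · simpa [h] using hz

theorem ConnIn.trans {U : Set (Pt d)} {x y z : Pt d} (h : ConnIn U x y) (h' : ConnIn U y z) :
    ConnIn U x z := by
  obtain ⟨τ, N, hp, rfl, rfl, hU⟩ := h'
  have key : ∀ l ≤ N, ConnIn U x (τ l) := by
    intro l
    induction l with
    | zero => exact fun _ => h
    | succ l ih => exact fun hl => (ih (by omega)).tail (hp l hl) (hU _ hl)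
  exact key N le_rfl

theorem connSet_of_connIn {S : Set (Pt d)} (x : Pt d) (h : ∀ y ∈ S, ConnIn S x y) : ConnSet S :=
  fun y hy z hz => (h y hy).symm.trans (h z hz)

theorem connSet_range_of_adj {p : ℕ → Pt d} (h : ∀ k, adj (p k) (p (k + 1))) :
    ConnSet (Set.range p) := by
  refine connSet_of_connIn (p 0) ?_
  rintro _ ⟨k, rfl⟩
  exact ⟨p, k, fun l _ => h l, rfl, rfl, fun l _ => ⟨l, rfl⟩⟩

theorem mem_fill_of_adj {A : Set (Pt d)} {x y : Pt d} (hx : x ∈ fill A) (hxA : x ∉ A)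
    (hxy : adj x y) : y ∈ fill A := by
  intro S hy hS hconn
  refine (hx (insert x S) (Set.mem_insert _ _) (Set.insert_subset hxA hS) ?_).subset
    (Set.subset_insert _ _)
  refine connSet_of_connIn y fun z hz => ?_
  rcases hz with rfl | hz
  · exact (ConnIn.refl (Set.mem_insert_of_mem _ hy)).tail (adj_symm hxy) (Set.mem_insert _ _)
  · exact (hconn y hy z hz).mono (Set.subset_insert _ _)

theorem mem_fill_of_isPath {A : Set (Pt d)} {τ : ℕ → Pt d} {N : ℕ} (hp : IsPath τ N)
    (h0 : τ 0 ∈ fill A) (hA : ∀ l < N, τ l ∉ A) : τ N ∈ fill A := by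
  have key : ∀ l ≤ N, τ l ∈ fill A := by
    intro l
    induction l with
    | zero => exact fun _ => h0
    | succ l ih => exact fun hl => mem_fill_of_adj (ih (by omega)) (hA l hl) (hp l hl)
  exact key N le_rfl

theorem ninf_le_iff {x y : Pt d} {r : ℕ} : ninf x y ≤ r ↔ ∀ j, (x j - y j).natAbs ≤ r := by
  simp [ninf, Finset.sup_le_iff]

theorem ninf_self (x : Pt d) : ninf x x = 0 := by
  simpa using (ninf_le_iff (x := x) (y := x) (r := 0)).2 (by simp)

theorem ninf_comm (x y : Pt d) : ninf x y = ninf y x :=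
  Finset.sup_congr rfl fun j _ => by rw [← Int.natAbs_neg, neg_sub]

/-- Two `*`-adjacent points are joined by a path through the corners of the cube they span. -/
theorem mem_fill_of_ninf_le_one {A : Set (Pt d)} {x y : Pt d} (hx : x ∈ fill A)
    (hxy : ninf x y ≤ 1) (hA : ∀ s : Finset (Fin d), s.piecewise y x ∉ A) : y ∈ fill A := by
  have key : ∀ s : Finset (Fin d), s.piecewise y x ∈ fill A := by
    intro s
    induction s using Finset.induction_on with
    | empty => simpa using hx
    | insert i s hi ih =>
      rcases Nat.le_one_iff_eq_zero_or_eq_one.1 (ninf_le_iff.1 hxy i) with h | h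
      · have : (insert i s).piecewise y x = s.piecewise y x := by
          rw [Finset.piecewise_insert]
          have hxi : y i = s.piecewise y x i := by
            rw [Finset.piecewise_eq_of_notMem _ _ _ hi]
            omega
          rw [hxi, Function.update_eq_self]
        rwa [this]
      · refine mem_fill_of_adj ih (hA s) (adj_of_eq_off i (fun j hj => ?_) ?_)
        · rw [Finset.piecewise_insert, Function.update_of_ne hj]
        · rwa [Finset.piecewise_insert_self, Finset.piecewise_eq_of_notMem _ _ _ hi]
  simpa using key Finset.univ

theorem ninf_piecewise_le {x y : Pt d} {r : ℕ} (hxy : ninf x y ≤ r) (s t : Finset (Fin d)) :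
    ninf (s.piecewise y x) (t.piecewise y x) ≤ r := by
  refine ninf_le_iff.2 fun j => ?_
  have := ninf_le_iff.1 hxy j
  by_cases hs : j ∈ s <;> by_cases ht : j ∈ t <;> simp [Finset.piecewise, hs, ht] <;> omega

theorem disjoint_fill {A B : Set (Pt d)} (i : Fin d) (hAB : Disjoint A (fill B))
    (hBA : Disjoint B (fill A)) : Disjoint (fill A) (fill B) := by
  classical
  rw [Set.disjoint_left] at *
  intro z hzA hzB
  let r : ℕ → Pt d := fun k => z + Pi.single i (k : ℤ)
  have hr : ∀ k, adj (r k) (r (k + 1)) := fun k =>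
    adj_of_eq_off i (fun j hj => by simp [r, hj]) (by simp [r])
  have hr0 : r 0 = z := by simp [r]
  have hinj : Function.Injective r := fun a b hab => by
    simpa [r] using congrFun hab i
  have hex : ∃ k, r k ∈ A ∪ B := by
    by_contra! hne
    refine Set.infinite_range_of_injective hinj (hzA _ ⟨0, hr0⟩ ?_ (connSet_range_of_adj hr))
    rintro _ ⟨k, rfl⟩ hk
    exact hne k (Or.inl hk)
  have hmin : ∀ l < Nat.find hex, r l ∉ A ∪ B := fun l hl => Nat.find_min hex hl
  rcases Nat.find_spec hex with h | h
  · exact hAB h (mem_fill_of_isPath (fun l _ => hr l) (hr0 ▸ hzB)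
      fun l hl hm => hmin l hl (Or.inr hm))
  · exact hBA h (mem_fill_of_isPath (fun l _ => hr l) (hr0 ▸ hzA)
      fun l hl hm => hmin l hl (Or.inl hm))

theorem farInf_fill {A B : Set (Pt d)} (i : Fin d) (hfar : farInf A B)
    (hAB : Disjoint A (fill B)) (hBA : Disjoint B (fill A)) : farInf (fill A) (fill B) := by
  intro x hx y hy
  by_contra! hxy
  have hdisj := Set.disjoint_left.1 (disjoint_fill i hAB hBA)
  by_cases hA : ∀ s : Finset (Fin d), s.piecewise y x ∉ A
  · exact hdisj (mem_fill_of_ninf_le_one hx hxy hA) hy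
  by_cases hB : ∀ s : Finset (Fin d), s.piecewise x y ∉ B
  · exact hdisj hx (mem_fill_of_ninf_le_one hy (ninf_comm x y ▸ hxy) hB)
  push Not at hA hB
  obtain ⟨s, hs⟩ := hA
  obtain ⟨t, ht⟩ := hB
  have h := ninf_piecewise_le hxy s tᶜ
  rw [Finset.piecewise_compl] at h
  exact absurd (hfar _ hs _ ht) (not_lt.2 h)

theorem IsTraj.infinite_image {w : ℤ → Pt d} (hw : IsTraj w) {T : Set ℤ} (hT : T.Infinite) :
    (w '' T).Infinite := by
  intro hfin
  obtain ⟨M, hM⟩ := (hfin.image fun x => n1 x 0).bddAbove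
  have h := hw.2.eventually (Filter.eventually_gt_atTop M)
  refine hT ((Filter.eventually_cofinite.1 h).subset fun l hl => ?_)
  exact not_lt.2 (hM ⟨_, ⟨l, hl, rfl⟩, rfl⟩)

theorem IsTraj.connSet_image_Ioi {w : ℤ → Pt d} (hw : IsTraj w) (k : ℤ) :
    ConnSet (w '' Set.Ioi k) := by
  have h : w '' Set.Ioi k = Set.range fun m : ℕ => w (k + 1 + m) := by
    ext z
    constructor
    · rintro ⟨l, hl, rfl⟩
      have : k < l := hl
      exact ⟨(l - k - 1).toNat, congrArg w (by omega)⟩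
    · rintro ⟨m, rfl⟩
      exact ⟨_, Set.mem_Ioi.2 (by omega), rfl⟩
  rw [h]
  refine connSet_range_of_adj fun m => ?_
  simpa [add_assoc] using hw.1 (k + 1 + m)

theorem IsTraj.reverse {w : ℤ → Pt d} (hw : IsTraj w) : IsTraj fun l => w (-l) := by
  refine ⟨fun l => adj_symm ?_, hw.2.comp neg_injective.tendsto_cofinite⟩
  simpa using hw.1 (-(l + 1))

theorem IsTraj.connSet_image_Iio {w : ℤ → Pt d} (hw : IsTraj w) (k : ℤ) :
    ConnSet (w '' Set.Iio k) := by
  have h := hw.reverse.connSet_image_Ioi (-k)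
  rwa [← Set.image_image w (fun l => -l), Set.image_neg_eq_neg, Set.neg_Ioi, neg_neg] at h

theorem disjoint_fill_of_infinite {A S : Set (Pt d)} (hS : S.Infinite) (hconn : ConnSet S)
    (hAS : Disjoint S A) : Disjoint S (fill A) :=
  Set.disjoint_left.2 fun _ hz hzA => hS (hzA S hz (Set.disjoint_left.1 hAS) hconn)

theorem farInf.disjoint {A B : Set (Pt d)} (h : farInf A B) : Disjoint A B :=
  Set.disjoint_left.2 fun z hA hB => by simpa [ninf_self] using h z hA z hB

theorem CutTime.farInf {w : ℤ → Pt d} {k : ℤ} (h : CutTime w k) :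
    farInf (w '' Set.Iio k) (w '' Set.Ioi k) := by
  rintro _ ⟨l, hl, rfl⟩ _ ⟨l', hl', rfl⟩
  exact h l hl l' hl'

theorem farInf.mono {A A' B B' : Set (Pt d)} (h : farInf A B) (hA : A' ⊆ A) (hB : B' ⊆ B) :
    farInf A' B' := fun x hx y hy => h x (hA hx) y (hB hy)

/-- the filled sausages are mutually exterior:
`d_∞(fill(𝒰_j), fill(𝒰_{j'})) > 1` for `j < j'`. -/
theorem statement14 (d : ℕ) (hd : 3 ≤ d) (w : ℤ → Pt d) (hw : IsTraj w)
    (J : ℕ) (n : ℕ → ℤ)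
    (hgap : ∀ j < J, n j + 2 ≤ n (j + 1))
    (hcut : ∀ j ≤ J, CutTime w (n j)) :
    ∀ j j' : ℕ, j < j' → j' < J →
      farInf (fill (sausage w n j)) (fill (sausage w n j')) := by
  intro j j' hjj' hj'
  have hmono : ∀ m, j + 1 ≤ m → m ≤ J → n (j + 1) ≤ n m := by
    intro m hm
    induction m, hm using Nat.le_induction with
    | base => exact fun _ => le_rfl
    | succ m _ ih =>
      intro hmJ
      have h₁ := ih (by omega)
      have h₂ := hgap m (by omega)
      omega
  have hle : n (j + 1) ≤ n j' := hmono j' hjj' hj'.le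
  have hcutj := (hcut j' hj'.le).farInf
  have hpast : sausage w n j ⊆ w '' Set.Iio (n (j + 1)) := Set.image_mono fun l hl => hl.2
  have hfuture : sausage w n j' ⊆ w '' Set.Ioi (n j') := Set.image_mono fun l hl => hl.1
  have hpast' : w '' Set.Iio (n (j + 1)) ⊆ w '' Set.Iio (n j') :=
    Set.image_mono (Set.Iio_subset_Iio hle)
  refine farInf_fill ⟨0, by omega⟩ (hcutj.mono (hpast.trans hpast') hfuture) ?_ ?_
  · exact (disjoint_fill_of_infinite (hw.infinite_image (Set.Iio_infinite _))
      (hw.connSet_image_Iio _) (hcutj.mono hpast' hfuture).disjoint).mono_left hpast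
  · exact (disjoint_fill_of_infinite (hw.infinite_image (Set.Ioi_infinite _))
      (hw.connSet_image_Ioi _)
      (hcutj.mono (hpast.trans hpast') subset_rfl).disjoint.symm).mono_left hfuture

end RI
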